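/- For an even non-trivial Dirichlet character χ mod an odd prime q, L(1,χ) = (2τ(χ)/q) Σ_{a=1}^{q-1} χ̄(a) log Γ(a/q), where τ(χ) = Σ_{a=1}^{q} χ(a) e^{2πia/q} is the Gauss sum. -/

import Mathlib

open Finset Real Complex

open HurwitzZeta Filter Topology Asymptotics

lemma one_sub_mul_exp_neg_mem_slitPlane {z : ℂ} (hz : ‖z‖ ≤ 1) (hz1 : z ≠ 1) {t : ℝ} (ht : 0 ≤ t) :
    1 - z * (rexp (-t) : ℂ) ∈ slitPlane := by
  left
  have hre : z.re < 1 := by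
    refine lt_of_le_of_ne ((re_le_norm z).trans hz) fun h ↦ hz1 ?_
    have h1 : z.re ^ 2 + z.im ^ 2 ≤ 1 := by
      rw [← Complex.sq_norm_sub_sq_re z]
      nlinarith [norm_nonneg z]
    have h2 : z.im = 0 := by rw [h] at h1; nlinarith [sq_nonneg z.im]
    exact Complex.ext (by simpa using h) (by simpa using h2)
  have he : rexp (-t) ≤ 1 := Real.exp_le_one_iff.mpr (by linarith)
  have hp := Real.exp_pos (-t)
  simp only [sub_re, one_re, re_mul_ofReal]
  nlinarith

section mellin
variable {z : ℂ} (hz : ‖z‖ ≤ 1) (hz1 : z ≠ 1)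
include hz hz1

lemma continuousOn_mul_exp_neg_div :
    ContinuousOn (fun t : ℝ ↦ z * (rexp (-t) : ℂ) / (1 - z * (rexp (-t) : ℂ))) (Set.Ici 0) :=
  ContinuousOn.div (by fun_prop) (by fun_prop)
    fun _ ht ↦ slitPlane_ne_zero (one_sub_mul_exp_neg_mem_slitPlane hz hz1 ht)

lemma locallyIntegrableOn_mul_exp_neg_div :
    MeasureTheory.LocallyIntegrableOn
      (fun t : ℝ ↦ z * (rexp (-t) : ℂ) / (1 - z * (rexp (-t) : ℂ))) (Set.Ioi 0) :=
  ((continuousOn_mul_exp_neg_div hz hz1).mono Set.Ioi_subset_Ici_self).locallyIntegrableOn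
    measurableSet_Ioi

omit hz hz1 in
lemma tendsto_one_sub_mul_exp_neg (z : ℂ) :
    Tendsto (fun t : ℝ ↦ 1 - z * (rexp (-t) : ℂ)) atTop (𝓝 1) := by
  have h : Tendsto (fun t : ℝ ↦ (rexp (-t) : ℂ)) atTop (𝓝 ((0 : ℝ) : ℂ)) :=
    (continuous_ofReal.tendsto 0).comp Real.tendsto_exp_neg_atTop_nhds_zero
  simpa using (h.const_mul z).const_sub 1

omit hz hz1 in
lemma isBigO_mul_exp_neg_div_atTop (z : ℂ) :
    (fun t : ℝ ↦ z * (rexp (-t) : ℂ) / (1 - z * (rexp (-t) : ℂ))) =O[atTop]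
      fun t ↦ rexp (-1 * t) := by
  have h1 : (fun t : ℝ ↦ z * (rexp (-t) : ℂ)) =O[atTop] fun t ↦ rexp (-1 * t) :=
    .of_bound ‖z‖ (.of_forall fun t ↦ by
      rw [norm_mul, norm_real, neg_one_mul])
  have h2 := ((tendsto_one_sub_mul_exp_neg z).inv₀ one_ne_zero).isBigO_one ℝ
  simpa [div_eq_mul_inv] using h1.mul h2

lemma isBigO_mul_exp_neg_div_zero :
    (fun t : ℝ ↦ z * (rexp (-t) : ℂ) / (1 - z * (rexp (-t) : ℂ))) =O[𝓝[>] 0]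
      fun t ↦ t ^ (-(0 : ℝ)) := by
  have h := ((continuousOn_mul_exp_neg_div hz hz1) 0 Set.self_mem_Ici).tendsto.mono_left
    (nhdsWithin_mono 0 Set.Ioi_subset_Ici_self)
  simpa using h.isBigO_one ℝ

lemma mellin_mul_exp_neg_div_one :
    mellin (fun t : ℝ ↦ z * (rexp (-t) : ℂ) / (1 - z * (rexp (-t) : ℂ))) 1 =
      -Complex.log (1 - z) := by
  have hconv : MellinConvergent
      (fun t : ℝ ↦ z * (rexp (-t) : ℂ) / (1 - z * (rexp (-t) : ℂ))) 1 :=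
    mellinConvergent_of_isBigO_rpow_exp one_pos (locallyIntegrableOn_mul_exp_neg_div hz hz1)
      (isBigO_mul_exp_neg_div_atTop z) (isBigO_mul_exp_neg_div_zero hz hz1) (by simp)
  have hderiv (t : ℝ) (ht : t ∈ Set.Ici 0) :
      HasDerivAt (fun t : ℝ ↦ Complex.log (1 - z * (rexp (-t) : ℂ)))
        (z * (rexp (-t) : ℂ) / (1 - z * (rexp (-t) : ℂ))) t := by
    have h := (((Real.hasDerivAt_exp (-t)).comp t (hasDerivAt_neg t)).ofReal_comp.const_mul
      z).const_sub 1
    convert! h.clog_real (one_sub_mul_exp_neg_mem_slitPlane hz hz1 ht) using 1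
    simp
  have hlim : Tendsto (fun t : ℝ ↦ Complex.log (1 - z * (rexp (-t) : ℂ))) atTop (𝓝 0) := by
    simpa using (tendsto_one_sub_mul_exp_neg z).clog one_mem_slitPlane
  simp only [MellinConvergent, sub_self, cpow_zero, one_smul] at hconv
  simpa [mellin] using MeasureTheory.integral_Ioi_of_hasDerivAt_of_tendsto' hderiv hconv hlim

end mellin

lemma HurwitzZeta.Gamma_mul_expZeta_eq_mellin (x : ℝ) {s : ℂ} (hs : 1 < s.re) :
    Complex.Gamma s * expZeta x s =
      mellin (fun t : ℝ ↦ cexp (2 * π * I * x) * (rexp (-t) : ℂ) /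
        (1 - cexp (2 * π * I * x) * (rexp (-t) : ℂ))) s := by
  set z := cexp (2 * π * I * x) with hzdef
  have hz : ‖z‖ = 1 := by
    rw [hzdef, show 2 * π * I * x = ((2 * π * x : ℝ) : ℂ) * I by push_cast; ring]
    exact norm_exp_ofReal_mul_I _
  have hs0 : s ≠ 0 := by rintro rfl; simp at hs; linarith
  have h1 := ((hasSum_nat_add_iff' 1).mpr (hasSum_expZeta_of_one_lt_re x hs)).mul_left
    (Complex.Gamma s)
  have h2 := hasSum_mellin (a := fun n : ℕ ↦ z ^ (n + 1)) (p := fun n ↦ (n + 1 : ℝ)) (s := s)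
    (F := fun t ↦ z * (rexp (-t) : ℂ) / (1 - z * (rexp (-t) : ℂ)))
    (fun n ↦ Or.inr (by positivity)) (by linarith) ?_ ?_
  · simp only [range_one, sum_singleton, CharP.cast_eq_zero, zero_cpow hs0, div_zero,
      sub_zero] at h1
    refine h1.unique (h2.congr_fun ?_)
    intro n
    rw [hzdef, ← Complex.exp_nat_mul]
    push_cast
    ring_nf
  · intro t ht
    have hlt : ‖z * (rexp (-t) : ℂ)‖ < 1 := by
      rw [norm_mul, hz, one_mul, norm_real, Real.norm_eq_abs, abs_of_pos (Real.exp_pos _)]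
      simpa using ht
    have h := (hasSum_geometric_of_norm_lt_one hlt).mul_left (z * (rexp (-t) : ℂ))
    rw [← div_eq_mul_inv] at h
    refine h.congr_fun fun n ↦ ?_
    rw [← pow_succ', mul_pow, ← ofReal_pow, ← Real.exp_nat_mul]
    push_cast
    ring_nf
  · simp only [norm_pow, hz, one_pow]
    exact_mod_cast (summable_nat_add_iff 1).mpr (Real.summable_one_div_nat_rpow.mpr hs)

lemma HurwitzZeta.expZeta_one {x : ℝ} (hx : (x : UnitAddCircle) ≠ 0) :
    expZeta x 1 = -Complex.log (1 - cexp (2 * π * I * x)) := by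
  have hz : ‖cexp (2 * π * I * x)‖ ≤ 1 := by
    rw [show 2 * π * I * x = ((2 * π * x : ℝ) : ℂ) * I by push_cast; ring]
    exact (norm_exp_ofReal_mul_I _).le
  have hz1 : cexp (2 * π * I * x) ≠ 1 := by
    rw [Ne, Complex.exp_eq_one_iff]
    rintro ⟨n, hn⟩
    refine hx ((AddCircle.coe_eq_zero_iff 1).mpr ⟨n, ?_⟩)
    have : (x : ℂ) = n := mul_left_cancel₀ two_pi_I_ne_zero (by rw [hn]; ring)
    rw [zsmul_one]
    exact_mod_cast this.symm
  rw [← mellin_mul_exp_neg_div_one hz hz1]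
  have hl : Tendsto (fun s ↦ Complex.Gamma s * expZeta x s) (𝓝[{s | 1 < s.re}] 1)
      (𝓝 (Complex.Gamma 1 * expZeta x 1)) := by
    refine (((differentiableAt_Gamma 1 fun n h ↦ ?_).continuousAt.mul
      (differentiable_expZeta_of_ne_zero hx 1).continuousAt).tendsto).mono_left nhdsWithin_le_nhds
    have := congr_arg Complex.re h
    simp at this
    linarith [(Nat.cast_nonneg n : (0 : ℝ) ≤ n)]
  have hr := (mellin_differentiableAt_of_isBigO_rpow_exp (s := 1) one_pos
    (locallyIntegrableOn_mul_exp_neg_div hz hz1) (isBigO_mul_exp_neg_div_atTop _)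
    (isBigO_mul_exp_neg_div_zero hz hz1) (by simp)).continuousAt.tendsto.mono_left
      (nhdsWithin_le_nhds (s := {s | 1 < s.re}))
  have hne : (𝓝[{s : ℂ | 1 < s.re}] 1).NeBot := by
    rw [← mem_closure_iff_nhdsWithin_neBot, Complex.closure_setOfPred_lt_re]
    simp
  rw [Complex.Gamma_one, one_mul] at hl
  refine tendsto_nhds_unique (hl.congr' ?_) hr
  filter_upwards [self_mem_nhdsWithin] with s hs using Gamma_mul_expZeta_eq_mellin x hs

lemma HurwitzZeta.cosZeta_one {x : ℝ} (hx : x ∈ Set.Ioo 0 1) :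
    cosZeta x 1 = -Real.log (2 * Real.sin (π * x)) := by
  have hx0 : (x : UnitAddCircle) ≠ 0 :=
    (AddCircle.coe_eq_zero_iff_of_mem_Ico (Set.Ioo_subset_Ico_self hx)).not.mpr hx.1.ne'
  have hx0' : ((-x : ℝ) : UnitAddCircle) ≠ 0 := by simpa using hx0
  have hsin : 0 < Real.sin (π * x) :=
    Real.sin_pos_of_pos_of_lt_pi (by have := hx.1; positivity)
      (by nlinarith [hx.2, Real.pi_pos])
  set w := 1 - cexp (2 * π * I * x) with hw
  have hconj : 1 - cexp (2 * π * I * (-x : ℝ)) = (starRingEnd ℂ) w := by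
    rw [hw, map_sub, map_one, ← Complex.exp_conj]
    simp [Complex.conj_ofNat]
  have hnorm : ‖w‖ = 2 * Real.sin (π * x) := by
    rw [hw, norm_sub_rev, show 2 * π * I * x = I * ((2 * π * x : ℝ) : ℂ) by push_cast; ring,
      Complex.norm_exp_I_mul_ofReal_sub_one, show 2 * π * x / 2 = π * x by ring,
      Real.norm_eq_abs, abs_of_pos (by positivity)]
  have harg : w.arg ≠ π := by
    refine (mem_slitPlane_iff_arg.mp ?_).1
    left
    have hcos : Real.cos (2 * (π * x)) < 1 := by
      rw [Real.cos_two_mul, Real.cos_sq']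
      nlinarith
    rw [hw, show 2 * π * I * x = ((2 * (π * x) : ℝ) : ℂ) * I by push_cast; ring, sub_re, one_re,
      Complex.exp_ofReal_mul_I_re]
    linarith
  rw [cosZeta_eq, ← QuotientAddGroup.mk_neg, expZeta_one hx0, expZeta_one hx0', hconj,
    Complex.log_conj _ harg, ← neg_add, Complex.add_conj, Complex.log_re, hnorm]
  push_cast
  ring

lemma log_Gamma_add_log_Gamma_one_sub {x : ℝ} (hx : x ∈ Set.Ioo 0 1) :
    Real.log (Real.Gamma x) + Real.log (Real.Gamma (1 - x)) =
      Real.log (2 * π) - Real.log (2 * Real.sin (π * x)) := by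
  have hsin : 0 < Real.sin (π * x) :=
    Real.sin_pos_of_pos_of_lt_pi (by have := hx.1; positivity)
      (by nlinarith [hx.2, Real.pi_pos])
  have h1 := Real.Gamma_pos_of_pos hx.1
  have h2 : 0 < Real.Gamma (1 - x) := Real.Gamma_pos_of_pos (by linarith [hx.2])
  rw [← Real.log_mul h1.ne' h2.ne', Real.Gamma_mul_Gamma_one_sub,
    ← Real.log_div (by positivity) (by positivity)]
  congr 1
  field_simp

lemma DirichletCharacter.IsPrimitive.of_prime {R : Type*} [CommMonoidWithZero R] {q : ℕ}
    (hq : q.Prime) {χ : DirichletCharacter R q} (hχ : χ ≠ 1) : χ.IsPrimitive := by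
  have : NeZero q := ⟨hq.ne_zero⟩
  exact (hq.eq_one_or_self_of_dvd _ χ.conductor_dvd_level).resolve_left
    fun h ↦ hχ (χ.eq_one_iff_conductor_eq_one.mpr h)

lemma ZMod.sum_eq_sum_Icc {M : Type*} [AddCommMonoid M] {q : ℕ} [NeZero q] {f : ZMod q → M}
    (hf : f 0 = 0) : ∑ j, f j = ∑ a ∈ Finset.Icc 1 (q - 1), f a := by
  rw [← Finset.sum_subset (Finset.subset_univ (Finset.univ.erase 0)) (by simpa using hf)]
  refine Finset.sum_bij' (fun j _ ↦ j.val) (fun a _ ↦ (a : ZMod q)) ?_ ?_ ?_ ?_ ?_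
  · intro j hj
    have h0 : j.val ≠ 0 := by simpa using hj
    have := ZMod.val_lt j
    simp only [Finset.mem_Icc]
    omega
  · intro a ha
    simp only [Finset.mem_Icc] at ha
    have := NeZero.pos q
    have h0 : (a : ZMod q).val ≠ 0 := by rw [ZMod.val_natCast_of_lt] <;> omega
    exact Finset.mem_erase.mpr ⟨(ZMod.val_ne_zero _).mp h0, Finset.mem_univ _⟩
  · simp
  · intro a ha
    simp only [Finset.mem_Icc] at ha
    have := NeZero.pos q
    exact ZMod.val_natCast_of_lt (by omega)
  · simp

lemma sum_mul_cosZeta_one_eq {q : ℕ} [NeZero q] {Φ : ZMod q → ℂ} (hΦ : Φ.Even) (hΦ0 : Φ 0 = 0)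
    (hsum : ∑ j, Φ j = 0) :
    ∑ j, Φ j * cosZeta (ZMod.toAddCircle j) 1 =
      2 * ∑ j, Φ j * (Real.log (Real.Gamma (j.val / q)) : ℂ) := by
  have hq : (0 : ℝ) < q := Nat.cast_pos.mpr (NeZero.pos q)
  have key (j : ZMod q) : Φ j * cosZeta (ZMod.toAddCircle j) 1 =
      Φ j * (Real.log (Real.Gamma (j.val / q)) : ℂ) +
        Φ (-j) * (Real.log (Real.Gamma ((-j).val / q)) : ℂ) - Φ j * Real.log (2 * π) := by
    rcases eq_or_ne j 0 with rfl | hj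
    · simp [hΦ0]
    have hx : (j.val / q : ℝ) ∈ Set.Ioo 0 1 := by
      refine ⟨div_pos (Nat.cast_pos.mpr (ZMod.val_pos.mpr hj)) hq, ?_⟩
      rw [div_lt_one hq]
      exact_mod_cast ZMod.val_lt j
    have hneg : ((-j).val / q : ℝ) = 1 - j.val / q := by
      have : NeZero j := ⟨hj⟩
      rw [ZMod.val_neg_of_ne_zero, Nat.cast_sub (ZMod.val_lt j).le]
      field_simp
    have h := congr_arg ((↑) : ℝ → ℂ) (log_Gamma_add_log_Gamma_one_sub hx)
    rw [ofReal_add, ofReal_sub] at h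
    rw [ZMod.toAddCircle_apply, cosZeta_one hx, hΦ j, hneg]
    linear_combination -Φ j * h
  have hreindex : ∑ j, Φ (-j) * (Real.log (Real.Gamma ((-j).val / q)) : ℂ) =
      ∑ j, Φ j * (Real.log (Real.Gamma (j.val / q)) : ℂ) :=
    Equiv.sum_comp (Equiv.neg (ZMod q)) fun j ↦ Φ j * (Real.log (Real.Gamma (j.val / q)) : ℂ)
  simp_rw [key, Finset.sum_sub_distrib, Finset.sum_add_distrib, hreindex, ← Finset.sum_mul, hsum]
  ring

open scoped ZMod in
lemma LFunction_dft_one_of_even {q : ℕ} [NeZero q] {Φ : ZMod q → ℂ} (hΦ : Φ.Even)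
    (hΦ0 : Φ 0 = 0) :
    ZMod.LFunction (𝓕 Φ) 1 = ∑ j, Φ j * cosZeta (ZMod.toAddCircle j) 1 := by
  rw [ZMod.LFunction_dft Φ (Or.inl hΦ0)]
  have hodd : Function.Odd fun j ↦ Φ j * (I * sinZeta (ZMod.toAddCircle (-j)) 1) := fun j ↦ by
    simp only [hΦ j, map_neg, sinZeta_neg, mul_neg]
  simp only [expZeta, mul_add, Finset.sum_add_distrib, hodd.sum_eq_zero, add_zero]
  simp only [map_neg, cosZeta_neg]

lemma gaussSum_stdAddChar_eq_sum_Icc {q : ℕ} [NeZero q] (χ : DirichletCharacter ℂ q)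
    (hχ : χ 0 = 0) :
    gaussSum χ ZMod.stdAddChar =
      ∑ a ∈ Finset.Icc 1 q, χ (a : ZMod q) * cexp (2 * π * I * a / q) := by
  have hterm (a : ℕ) : ZMod.stdAddChar (a : ZMod q) = cexp (2 * π * I * a / q) := by
    simpa using ZMod.stdAddChar_coe (N := q) a
  rw [gaussSum, ZMod.sum_eq_sum_Icc (by simp [hχ])]
  simp_rw [hterm]
  refine Finset.sum_subset (Finset.Icc_subset_Icc_right (Nat.sub_le q 1)) fun a ha ha' ↦ ?_
  simp only [Finset.mem_Icc] at ha ha'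
  obtain rfl : a = q := by omega
  simp [hχ]

theorem L_one_even_eq_gauss_sum_logGamma (q : ℕ) [NeZero q] (hq : q.Prime) (hodd : Odd q)
    (χ : DirichletCharacter ℂ q) (hχ : χ ≠ 1) (hχeven : χ.Even) :
    DirichletCharacter.LFunction χ 1 =
      2 * (∑ a ∈ Finset.Icc 1 q, χ (a : ZMod q) *
            Complex.exp (2 * Real.pi * Complex.I * a / q)) / q *
        ∑ a ∈ Finset.Icc 1 (q - 1),
          (χ.ringHomComp (starRingEnd ℂ)) (a : ZMod q) *
            (Real.log (Real.Gamma ((a : ℝ) / q)) : ℂ) := by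
  have : Fact q.Prime := ⟨hq⟩
  have hinv : χ.ringHomComp (starRingEnd ℂ) = χ⁻¹ := by
    ext a
    simpa using MulChar.star_apply' χ a
  have hinv1 : χ⁻¹ ≠ 1 := inv_ne_one.mpr hχ
  have heven : Function.Even ⇑χ⁻¹ := fun j ↦ by
    rw [← hinv, MulChar.ringHomComp_apply, MulChar.ringHomComp_apply, hχeven.eval_neg]
  have h0 : χ⁻¹ 0 = 0 := χ⁻¹.map_nonunit not_isUnit_zero
  have hdft : ZMod.dft ⇑χ⁻¹ = fun j ↦ gaussSum χ⁻¹ ZMod.stdAddChar * χ j := by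
    ext j
    rw [(DirichletCharacter.IsPrimitive.of_prime hq hinv1).fourierTransform_eq_inv_mul_gaussSum,
      inv_inv, hχeven.eval_neg, mul_comm]
  have hL := LFunction_dft_one_of_even heven h0
  rw [sum_mul_cosZeta_one_eq heven h0 (MulChar.sum_eq_zero_of_ne_one hinv1), hdft] at hL
  have hL' : ZMod.LFunction (fun j ↦ gaussSum χ⁻¹ ZMod.stdAddChar * χ j) 1 =
      gaussSum χ⁻¹ ZMod.stdAddChar * DirichletCharacter.LFunction χ 1 := by
    simp only [DirichletCharacter.LFunction, ZMod.LFunction, Finset.mul_sum]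
    exact Finset.sum_congr rfl fun j _ ↦ by ring
  have hprod : gaussSum χ ZMod.stdAddChar * gaussSum χ⁻¹ ZMod.stdAddChar = q := by
    have h := gaussSum_mul_gaussSum_eq_card hχ (ZMod.isPrimitive_stdAddChar q)
    rw [← mul_gaussSum_inv_eq_gaussSum χ⁻¹, inv_inv, ZMod.card] at h
    simpa [heven 1] using h
  have hq0 : (q : ℂ) ≠ 0 := Nat.cast_ne_zero.mpr hq.ne_zero
  have hsum : ∑ j : ZMod q, χ⁻¹ j * (Real.log (Real.Gamma (j.val / q)) : ℂ) =
      ∑ a ∈ Finset.Icc 1 (q - 1),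
        χ⁻¹ (a : ZMod q) * (Real.log (Real.Gamma ((a : ℝ) / q)) : ℂ) := by
    rw [ZMod.sum_eq_sum_Icc (by simp [h0])]
    refine Finset.sum_congr rfl fun a ha ↦ ?_
    simp only [Finset.mem_Icc] at ha
    rw [ZMod.val_natCast_of_lt (by omega)]
  rw [hL', hsum] at hL
  rw [hinv, ← gaussSum_stdAddChar_eq_sum_Icc χ (χ.map_nonunit not_isUnit_zero), div_mul_eq_mul_div,
    eq_div_iff hq0, ← hprod]
  linear_combination gaussSum χ ZMod.stdAddChar * hL
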